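/- Let {s_n}_{n ≥ k} be a sequence of nonnegative integers such that (a) 2·s_n ≤ n − 3 for all n ≥ k, (b) s_n/n → 0 as n → ∞, and (c) 2^{s_n} ≥ n² for all n ≥ k. Let T_n = T_{n,s_n} and let G_n be obtained from T_n by adding the edge uv. Then Den(T_n) − Den(G_n) → 1/3 as n → ∞. -/

import Mathlib

open Filter Topology

noncomputable section

namespace SubtreePaper

/-- The set of subtrees of `G`: subgraphs of `G` that are (nonempty) trees. -/
def subtrees {V : Type*} (G : SimpleGraph V) : Set G.Subgraph :=
  {H | H.coe.IsTree}

/-- The number of subtrees of `G`. -/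
def numSubtrees {V : Type*} (G : SimpleGraph V) : ℕ := (subtrees G).ncard

/-- The mean subtree order of `G`. -/
def mu {V : Type*} (G : SimpleGraph V) : ℝ :=
  (∑ᶠ H ∈ subtrees G, (H.verts.ncard : ℝ)) / (numSubtrees G)

/-- The density of `G`. -/
def den {V : Type*} [Fintype V] (G : SimpleGraph V) : ℝ :=
  mu G / (Fintype.card V)

/-- The local mean subtree order of `G` at an edge `e`. -/
def muEdge {V : Type*} (G : SimpleGraph V) (e : Sym2 V) : ℝ :=
  (∑ᶠ H ∈ {H ∈ subtrees G | e ∈ H.edgeSet}, (H.verts.ncard : ℝ)) /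
    ({H ∈ subtrees G | e ∈ H.edgeSet}.ncard)

/-- The local mean subtree order of `G` at a vertex `u`. -/
def muVert {V : Type*} (G : SimpleGraph V) (u : V) : ℝ :=
  (∑ᶠ H ∈ {H ∈ subtrees G | u ∈ H.verts}, (H.verts.ncard : ℝ)) /
    ({H ∈ subtrees G | u ∈ H.verts}.ncard)

/-- The graph obtained from `G` by adding an edge between `u` and `v`. -/
def addEdge {V : Type*} (G : SimpleGraph V) (u v : V) : SimpleGraph V :=
  G ⊔ SimpleGraph.fromEdgeSet {s(u, v)}


/-- The tree `T_{n,s}`: a path on the vertices `Sum.inl 0, …, Sum.inl (n - 2s - 1)`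
(of order `n - 2s`), with the `s` leaves `Sum.inr (Sum.inl j)` attached to the
endvertex `Sum.inl 0`, and the `s` leaves `Sum.inr (Sum.inr j)` attached to the
endvertex `Sum.inl (n - 2s - 1)`. -/
def Tns (n s : ℕ) : SimpleGraph (Fin (n - 2 * s) ⊕ Fin s ⊕ Fin s) :=
  SimpleGraph.fromRel fun a b =>
    match a, b with
    | Sum.inl i, Sum.inl j => (i : ℕ) + 1 = (j : ℕ)
    | Sum.inl i, Sum.inr (Sum.inl _) => (i : ℕ) = 0
    | Sum.inl i, Sum.inr (Sum.inr _) => (i : ℕ) = n - 2 * s - 1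
    | _, _ => False

/-- The endvertex `u` of the path in `T_{n,s}`. -/
def pu (n s : ℕ) (h : 2 * s + 3 ≤ n) : Fin (n - 2 * s) ⊕ Fin s ⊕ Fin s :=
  Sum.inl ⟨0, by omega⟩

/-- The endvertex `v` of the path in `T_{n,s}`. -/
def pv (n s : ℕ) (h : 2 * s + 3 ≤ n) : Fin (n - 2 * s) ⊕ Fin s ⊕ Fin s :=
  Sum.inl ⟨n - 2 * s - 1, by omega⟩

/-- The graph `G_{n,s}`, obtained from `T_{n,s}` by adding the edge `uv`. -/
def Gns (n s : ℕ) (h : 2 * s + 3 ≤ n) :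
    SimpleGraph (Fin (n - 2 * s) ⊕ Fin s ⊕ Fin s) :=
  addEdge (Tns n s) (pu n s h) (pv n s h)

/-- The density of `G_{n,s}` (with junk value `0` when `2s > n - 3`). -/
def GnsDen (n s : ℕ) : ℝ :=
  if h : 2 * s + 3 ≤ n then den (Gns n s h) else 0

/-- The number of subtrees of `G_{n,s}` (with junk value `0` when `2s > n - 3`). -/
def GnsNum (n s : ℕ) : ℕ :=
  if h : 2 * s + 3 ≤ n then numSubtrees (Gns n s h) else 0

/-- A finite graph in which every vertex other than the root `r` has a parent of smaller height, and
all of whose edges join a vertex to its parent, is a tree. -/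
lemma isTree_of_parent {V : Type*} [Finite V] (G : SimpleGraph V) (r : V) (p : V → V)
    (h : V → ℕ) (hp : ∀ v, v ≠ r → G.Adj v (p v) ∧ h (p v) < h v)
    (hadj : ∀ a b, G.Adj a b → (a ≠ r ∧ p a = b) ∨ (b ≠ r ∧ p b = a)) : G.IsTree := by
  classical
  have reach : ∀ k v, h v = k → G.Reachable v r := by
    intro k
    induction k using Nat.strong_induction_on with
    | _ k ih =>
      intro v hv
      by_cases hvr : v = r
      · subst hvr; rfl
      · obtain ⟨h1, h2⟩ := hp v hvr
        exact h1.reachable.trans (ih _ (hv ▸ h2) _ rfl)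
  have hconn : G.Connected :=
    { preconnected := fun a b => (reach _ a rfl).trans (reach _ b rfl).symm
      nonempty := ⟨r⟩ }
  rw [SimpleGraph.isTree_iff_connected_and_card]
  refine ⟨hconn, le_antisymm ?_ hconn.card_vert_le_card_edgeSet_add_one⟩
  have hsub : G.edgeSet ⊆ (fun v => s(v, p v)) '' {r}ᶜ := by
    intro e
    induction e with
    | _ a b =>
      intro hab
      rcases hadj a b hab with ⟨h1, h2⟩ | ⟨h1, h2⟩
      · exact ⟨a, h1, by simp [h2]⟩
      · exact ⟨b, h1, by simp [h2, Sym2.eq_swap]⟩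
  have h1 : Nat.card G.edgeSet ≤ ({r}ᶜ : Set V).ncard :=
    (Set.ncard_le_ncard hsub).trans (Set.ncard_image_le)
  have h2 := Set.ncard_add_ncard_compl ({r} : Set V)
  rw [Set.ncard_singleton] at h2
  omega

lemma subgraph_isTree_of_parent {V : Type*} [Finite V] {G : SimpleGraph V} (H : G.Subgraph)
    (r : V) (hr : r ∈ H.verts) (p : V → V) (h : V → ℕ)
    (hp : ∀ v ∈ H.verts, v ≠ r → H.Adj v (p v) ∧ h (p v) < h v)
    (hadj : ∀ a b, H.Adj a b → (a ≠ r ∧ p a = b) ∨ (b ≠ r ∧ p b = a)) : H.coe.IsTree := by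
  classical
  refine isTree_of_parent H.coe ⟨r, hr⟩
    (fun v => if hv : p v ∈ H.verts then ⟨p v, hv⟩ else v) (fun v => h v) ?_ ?_
  · rintro ⟨v, hv⟩ hvr
    have hvr' : v ≠ r := fun h => hvr (Subtype.ext h)
    obtain ⟨h1, h2⟩ := hp v hv hvr'
    simp only [h1.snd_mem, dif_pos, SimpleGraph.Subgraph.coe_adj]
    exact ⟨h1, h2⟩
  · rintro ⟨a, ha⟩ ⟨b, hb⟩ hab
    rcases hadj a b hab with ⟨h1, rfl⟩ | ⟨h1, rfl⟩
    · left; simp [hb, h1]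
    · right; simp [ha, h1]

/-- A connected subgraph has an edge across every cut separating two of its vertices. -/
lemma exists_adj_cut {V : Type*} {G : SimpleGraph V} {H : G.Subgraph} (hH : H.coe.Connected)
    {a b : V} (ha : a ∈ H.verts) (hb : b ∈ H.verts) (S : Set V) (haS : a ∈ S) (hbS : b ∉ S) :
    ∃ x y, H.Adj x y ∧ x ∈ S ∧ y ∉ S := by
  obtain ⟨w⟩ := hH.preconnected ⟨a, ha⟩ ⟨b, hb⟩
  obtain ⟨d, -, h1, h2⟩ := w.exists_boundary_dart (Subtype.val ⁻¹' S) haS hbS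
  exact ⟨d.fst, d.snd, d.adj, h1, h2⟩

/-- The vertex type of `T_{n,s}`. -/
abbrev Vtx (n s : ℕ) : Type := Fin (n - 2 * s) ⊕ Fin s ⊕ Fin s

section Adjacency

variable {n s : ℕ}

lemma Tns_adj_inl_inl (i j : Fin (n - 2 * s)) :
    (Tns n s).Adj (.inl i) (.inl j) ↔ (i : ℕ) + 1 = j ∨ (j : ℕ) + 1 = i := by
  simp only [Tns, SimpleGraph.fromRel_adj, ne_eq, Sum.inl.injEq, Fin.ext_iff]
  omega

lemma Tns_adj_inl_left (i : Fin (n - 2 * s)) (l : Fin s) :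
    (Tns n s).Adj (.inl i) (.inr (.inl l)) ↔ (i : ℕ) = 0 := by
  simp [Tns]

lemma Tns_adj_left_inl (i : Fin (n - 2 * s)) (l : Fin s) :
    (Tns n s).Adj (.inr (.inl l)) (.inl i) ↔ (i : ℕ) = 0 := by
  simp [Tns]

lemma Tns_adj_inl_right (i : Fin (n - 2 * s)) (l : Fin s) :
    (Tns n s).Adj (.inl i) (.inr (.inr l)) ↔ (i : ℕ) = n - 2 * s - 1 := by
  simp [Tns]

lemma Tns_adj_right_inl (i : Fin (n - 2 * s)) (l : Fin s) :
    (Tns n s).Adj (.inr (.inr l)) (.inl i) ↔ (i : ℕ) = n - 2 * s - 1 := by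
  simp [Tns]

lemma not_Tns_adj_inr_inr (a b : Fin s ⊕ Fin s) : ¬ (Tns n s).Adj (.inr a) (.inr b) := by
  simp [Tns]

lemma Gns_adj (h : 2 * s + 3 ≤ n) (a b : Vtx n s) :
    (Gns n s h).Adj a b ↔ (Tns n s).Adj a b ∨
      (a = pu n s h ∧ b = pv n s h) ∨ (a = pv n s h ∧ b = pu n s h) := by
  have huv : pu n s h ≠ pv n s h := by
    simp only [pu, pv, ne_eq, Sum.inl.injEq, Fin.ext_iff]; omega
  simp only [Gns, addEdge, SimpleGraph.sup_adj, SimpleGraph.fromEdgeSet_adj,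
    Set.mem_singleton_iff, Sym2.eq_iff]
  constructor
  · rintro (h1 | ⟨h1, -⟩)
    · exact .inl h1
    · exact .inr h1
  · rintro (h1 | h1)
    · exact .inl h1
    · refine .inr ⟨h1, ?_⟩
      rcases h1 with ⟨rfl, rfl⟩ | ⟨rfl, rfl⟩
      · exact huv
      · exact huv.symm

lemma Gns_adj_inl_inl (h : 2 * s + 3 ≤ n) (i j : Fin (n - 2 * s)) :
    (Gns n s h).Adj (.inl i) (.inl j) ↔ (i : ℕ) + 1 = j ∨ (j : ℕ) + 1 = i ∨
      ((i : ℕ) = 0 ∧ (j : ℕ) = n - 2 * s - 1) ∨ ((j : ℕ) = 0 ∧ (i : ℕ) = n - 2 * s - 1) := by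
  rw [Gns_adj, Tns_adj_inl_inl]
  simp only [pu, pv, Sum.inl.injEq, Fin.ext_iff]
  tauto

lemma Gns_adj_inl_left (h : 2 * s + 3 ≤ n) (i : Fin (n - 2 * s)) (l : Fin s) :
    (Gns n s h).Adj (.inl i) (.inr (.inl l)) ↔ (i : ℕ) = 0 := by
  rw [Gns_adj, Tns_adj_inl_left]; simp [pu, pv]

lemma Gns_adj_left_inl (h : 2 * s + 3 ≤ n) (i : Fin (n - 2 * s)) (l : Fin s) :
    (Gns n s h).Adj (.inr (.inl l)) (.inl i) ↔ (i : ℕ) = 0 := by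
  rw [Gns_adj, Tns_adj_left_inl]; simp [pu, pv]

lemma Gns_adj_inl_right (h : 2 * s + 3 ≤ n) (i : Fin (n - 2 * s)) (l : Fin s) :
    (Gns n s h).Adj (.inl i) (.inr (.inr l)) ↔ (i : ℕ) = n - 2 * s - 1 := by
  rw [Gns_adj, Tns_adj_inl_right]; simp [pu, pv]

lemma Gns_adj_right_inl (h : 2 * s + 3 ≤ n) (i : Fin (n - 2 * s)) (l : Fin s) :
    (Gns n s h).Adj (.inr (.inr l)) (.inl i) ↔ (i : ℕ) = n - 2 * s - 1 := by
  rw [Gns_adj, Tns_adj_right_inl]; simp [pu, pv]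

lemma not_Gns_adj_inr_inr (h : 2 * s + 3 ≤ n) (a b : Fin s ⊕ Fin s) :
    ¬ (Gns n s h).Adj (.inr a) (.inr b) := by
  rw [Gns_adj]; simp [pu, pv, not_Tns_adj_inr_inr]

end Adjacency

section AvoidingChord

variable {n s : ℕ}

/-- The position of a vertex along the path; a leaf has the position of its neighbour. -/
def pos (n s : ℕ) : Vtx n s → ℕ
  | .inl i => i
  | .inr (.inl _) => 0
  | .inr (.inr _) => n - 2 * s - 1

variable {K : SimpleGraph (Vtx n s)} {H : K.Subgraph}

/-- A connected subgraph of `T_{n,s}` contains every path edge between two of its vertices. -/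
lemma adj_of_pos_le (hH : H.coe.Connected) (hle : ∀ a b, H.Adj a b → (Tns n s).Adj a b)
    {a b : Vtx n s} (ha : a ∈ H.verts) (hb : b ∈ H.verts) (k k' : Fin (n - 2 * s))
    (hk : (k : ℕ) + 1 = k') (hak : pos n s a ≤ k) (hkb : (k : ℕ) < pos n s b) :
    H.Adj (.inl k) (.inl k') := by
  obtain ⟨x, y, hxy, hx, hy⟩ := exists_adj_cut hH ha hb {z | pos n s z ≤ k} hak (by simpa using hkb)
  have hT := hle x y hxy
  simp only [Set.mem_ofPred_eq] at hx hy
  rcases x with x | x | x <;> rcases y with y | y | y <;>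
    simp only [Tns_adj_inl_inl, Tns_adj_inl_left, Tns_adj_left_inl, Tns_adj_inl_right,
      Tns_adj_right_inl, not_Tns_adj_inr_inr, pos] at hT hx hy <;> try omega
  have h1 : x = k := Fin.ext (by omega)
  have h2 : y = k' := Fin.ext (by omega)
  exact h1 ▸ h2 ▸ hxy

lemma exists_adj_of_ne (hH : H.coe.Connected) {a b : Vtx n s} (ha : a ∈ H.verts)
    (hb : b ∈ H.verts) (hab : a ≠ b) : ∃ c, H.Adj a c := by
  obtain ⟨x, y, hxy, hx, -⟩ := exists_adj_cut hH ha hb {a} rfl (by simpa using hab.symm)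
  exact ⟨y, (Set.mem_singleton_iff.1 hx) ▸ hxy⟩

lemma left_adj (hH : H.coe.Connected) (hle : ∀ a b, H.Adj a b → (Tns n s).Adj a b)
    {l : Fin s} (hl : .inr (.inl l) ∈ H.verts) {b : Vtx n s} (hb : b ∈ H.verts)
    (hne : .inr (.inl l) ≠ b) (i : Fin (n - 2 * s)) (hi : (i : ℕ) = 0) :
    H.Adj (.inr (.inl l)) (.inl i) := by
  obtain ⟨c, hc⟩ := exists_adj_of_ne hH hl hb hne
  have hT := hle _ _ hc
  rcases c with c | c
  · rw [Tns_adj_left_inl] at hT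
    rwa [show i = c from Fin.ext (by omega)]
  · exact absurd hT (not_Tns_adj_inr_inr _ _)

lemma right_adj (hH : H.coe.Connected) (hle : ∀ a b, H.Adj a b → (Tns n s).Adj a b)
    {l : Fin s} (hl : .inr (.inr l) ∈ H.verts) {b : Vtx n s} (hb : b ∈ H.verts)
    (hne : .inr (.inr l) ≠ b) (i : Fin (n - 2 * s)) (hi : (i : ℕ) = n - 2 * s - 1) :
    H.Adj (.inr (.inr l)) (.inl i) := by
  obtain ⟨c, hc⟩ := exists_adj_of_ne hH hl hb hne
  have hT := hle _ _ hc
  rcases c with c | c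
  · rw [Tns_adj_right_inl] at hT
    rwa [show i = c from Fin.ext (by omega)]
  · exact absurd hT (not_Tns_adj_inr_inr _ _)

/-- A connected subgraph of `T_{n,s}` is induced. -/
lemma adj_iff_of_avoiding (hH : H.coe.Connected) (hle : ∀ a b, H.Adj a b → (Tns n s).Adj a b)
    (a b : Vtx n s) : H.Adj a b ↔ (Tns n s).Adj a b ∧ a ∈ H.verts ∧ b ∈ H.verts := by
  refine ⟨fun h => ⟨hle a b h, h.fst_mem, h.snd_mem⟩, ?_⟩
  rintro ⟨hT, ha, hb⟩
  rcases a with a | a | a <;> rcases b with b | b | b <;>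
    simp only [Tns_adj_inl_inl, Tns_adj_inl_left, Tns_adj_left_inl, Tns_adj_inl_right,
      Tns_adj_right_inl, not_Tns_adj_inr_inr] at hT
  · rcases hT with hT | hT
    · exact adj_of_pos_le hH hle ha hb a b hT le_rfl (by simp only [pos]; omega)
    · exact (adj_of_pos_le hH hle hb ha b a hT le_rfl (by simp only [pos]; omega)).symm
  · exact (left_adj hH hle hb ha (by simp) a hT).symm
  · exact (right_adj hH hle hb ha (by simp) a hT).symm
  · exact left_adj hH hle ha hb (by simp) b hT
  · exact right_adj hH hle ha hb (by simp) b hT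

/-- The vertex set formed by the path vertices from `i` to `j` and the leaves in `L`. -/
def spanVerts (i j : Fin (n - 2 * s)) (L : Set (Fin s ⊕ Fin s)) : Set (Vtx n s)
  | .inl x => i ≤ x ∧ x ≤ j
  | .inr l => l ∈ L

/-- The path vertices of a connected subgraph of `T_{n,s}` form an interval. -/
lemma exists_spanVerts (hH : H.coe.Connected) (hle : ∀ a b, H.Adj a b → (Tns n s).Adj a b)
    {x : Fin (n - 2 * s)} (hx : .inl x ∈ H.verts) :
    ∃ i j, .inl i ∈ H.verts ∧ .inl j ∈ H.verts ∧
      H.verts = spanVerts i j {l | .inr l ∈ H.verts} := by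
  classical
  have hne : (Finset.univ.filter fun z : Fin (n - 2 * s) => (.inl z : Vtx n s) ∈ H.verts).Nonempty :=
    ⟨x, by simpa using hx⟩
  obtain ⟨j, hj, hjmax⟩ := Finset.exists_max_image _ id hne
  obtain ⟨i, hi, himin⟩ := Finset.exists_min_image _ id hne
  simp only [Finset.mem_filter, Finset.mem_univ, true_and, id] at hj hjmax hi himin
  refine ⟨i, j, hi, hj, ?_⟩
  ext z
  rcases z with z | z
  · refine ⟨fun hz => ⟨himin z hz, hjmax z hz⟩, fun ⟨h1, h2⟩ => ?_⟩
    rcases h2.eq_or_lt with rfl | h2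
    · exact hj
    · have hz : (z : ℕ) < j := h2
      exact (adj_of_pos_le hH hle hi hj z ⟨z + 1, by omega⟩ rfl h1 hz).fst_mem
  · rfl

/-- Codes for the vertex sets of the connected subgraphs of `T_{n,s}`: with both ends of the path,
with the left end only, with the right end only, with inner path vertices only, or a single leaf. -/
abbrev SpanCode (n s : ℕ) : Type :=
  Set (Fin s ⊕ Fin s) ⊕ (Set (Fin s) × Fin (n - 2 * s)) ⊕ (Set (Fin s) × Fin (n - 2 * s)) ⊕
    (Fin (n - 2 * s) × Fin (n - 2 * s)) ⊕ (Fin s ⊕ Fin s)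

/-- The vertex set with a given code. -/
def SpanCode.verts (u v : Fin (n - 2 * s)) : SpanCode n s → Set (Vtx n s)
  | .inl L => spanVerts u v L
  | .inr (.inl (L, j)) => spanVerts u j (Sum.inl '' L)
  | .inr (.inr (.inl (L, i))) => spanVerts i v (Sum.inr '' L)
  | .inr (.inr (.inr (.inl (i, j)))) => spanVerts i j ∅
  | .inr (.inr (.inr (.inr l))) => {.inr l}

lemma exists_spanCode (hn : 2 * s + 3 ≤ n) (hH : H.coe.Connected)
    (hle : ∀ a b, H.Adj a b → (Tns n s).Adj a b) :
    H.verts ∈ Set.range (SpanCode.verts (n := n) (s := s) ⟨0, by omega⟩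
      ⟨n - 2 * s - 1, by omega⟩) := by
  set u : Fin (n - 2 * s) := ⟨0, by omega⟩ with hu
  set v : Fin (n - 2 * s) := ⟨n - 2 * s - 1, by omega⟩ with hv
  have hleft : ∀ l b, .inr (.inl l) ∈ H.verts → b ∈ H.verts → .inr (.inl l) ≠ b →
      .inl u ∈ H.verts := fun l b h1 h2 h3 => (left_adj hH hle h1 h2 h3 u rfl).snd_mem
  have hright : ∀ l b, .inr (.inr l) ∈ H.verts → b ∈ H.verts → .inr (.inr l) ≠ b →
      .inl v ∈ H.verts := fun l b h1 h2 h3 => (right_adj hH hle h1 h2 h3 v rfl).snd_mem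
  by_cases hx : ∃ x, (.inl x : Vtx n s) ∈ H.verts
  · obtain ⟨x, hx⟩ := hx
    obtain ⟨i, j, hi, hj, hspan⟩ := exists_spanVerts hH hle hx
    have mem_inl : ∀ z, .inl z ∈ H.verts ↔ i ≤ z ∧ z ≤ j := by
      intro z
      rw [hspan]
      rfl
    have hiu : .inl u ∈ H.verts → i = u := fun h =>
      le_antisymm ((mem_inl u).1 h).1 (Fin.le_def.2 (Nat.zero_le _))
    have hjv : .inl v ∈ H.verts → j = v := fun h =>
      le_antisymm (Fin.le_def.2 (by simp only [hv]; omega)) ((mem_inl v).1 h).2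
    by_cases h1 : .inl u ∈ H.verts <;> by_cases h2 : .inl v ∈ H.verts
    · refine ⟨.inl {l | .inr l ∈ H.verts}, ?_⟩
      rw [hiu h1, hjv h2] at hspan
      exact hspan.symm
    · refine ⟨.inr (.inl ({l | .inr (.inl l) ∈ H.verts}, j)), ?_⟩
      rw [hiu h1] at hspan
      rw [hspan]
      simp only [SpanCode.verts]
      congr 1
      ext (l | l)
      · simp [← hspan]
      · simp only [← hspan, Set.mem_image, Set.mem_ofPred_eq, reduceCtorEq, and_false, exists_false,
          false_iff]
        exact fun h => h2 (hright l _ h hx (by simp))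
    · refine ⟨.inr (.inr (.inl ({l | .inr (.inr l) ∈ H.verts}, i))), ?_⟩
      rw [hjv h2] at hspan
      rw [hspan]
      simp only [SpanCode.verts]
      congr 1
      ext (l | l)
      · simp only [← hspan, Set.mem_image, Set.mem_ofPred_eq, reduceCtorEq, and_false, exists_false,
          false_iff]
        exact fun h => h1 (hleft l _ h hx (by simp))
      · simp [← hspan]
    · refine ⟨.inr (.inr (.inr (.inl (i, j)))), ?_⟩
      rw [hspan]
      simp only [SpanCode.verts]
      congr 1
      ext (l | l)
      · simp only [Set.mem_ofPred_eq, Set.mem_empty_iff_false, false_iff]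
        exact fun h => h1 (hleft l _ h hx (by simp))
      · simp only [Set.mem_ofPred_eq, Set.mem_empty_iff_false, false_iff]
        exact fun h => h2 (hright l _ h hx (by simp))
  · push Not at hx
    obtain ⟨⟨a, ha⟩⟩ := hH.nonempty
    rcases a with a | a
    · exact absurd ha (hx a)
    · refine ⟨.inr (.inr (.inr (.inr a))), ?_⟩
      simp only [SpanCode.verts]
      refine (Set.eq_singleton_iff_unique_mem.2 ⟨ha, fun b hb => ?_⟩).symm
      by_contra hne
      rcases a with a | a
      · exact hx _ (hleft a b ha hb (Ne.symm hne))
      · exact hx _ (hright a b ha hb (Ne.symm hne))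

lemma ncard_avoiding_le (hn : 2 * s + 3 ≤ n) (hs : n ≤ 2 ^ s) (K : SimpleGraph (Vtx n s)) :
    {H ∈ subtrees K | ∀ a b, H.Adj a b → (Tns n s).Adj a b}.ncard ≤ 4 ^ s + 4 * n * 2 ^ s := by
  classical
  set O := {H ∈ subtrees K | ∀ a b, H.Adj a b → (Tns n s).Adj a b}
  have hinj : Set.InjOn SimpleGraph.Subgraph.verts O := by
    rintro H ⟨hH, hle⟩ H' ⟨hH', hle'⟩ heq
    have hc : H.coe.IsTree := hH
    have hc' : H'.coe.IsTree := hH'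
    refine SimpleGraph.Subgraph.ext heq ?_
    ext a b
    rw [adj_iff_of_avoiding hc.connected hle, adj_iff_of_avoiding hc'.connected hle', heq]
  rw [← hinj.ncard_image]
  have hsub : SimpleGraph.Subgraph.verts '' O ⊆ Set.range (SpanCode.verts (n := n) (s := s)
      ⟨0, by omega⟩ ⟨n - 2 * s - 1, by omega⟩) := by
    rintro _ ⟨H, ⟨hH, hle⟩, rfl⟩
    exact exists_spanCode hn (SimpleGraph.IsTree.connected hH) hle
  refine (Set.ncard_le_ncard hsub).trans ?_
  rw [← Set.image_univ]
  refine le_trans (Set.ncard_image_le) ?_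
  rw [Set.ncard_univ, Nat.card_eq_fintype_card]
  simp only [Fintype.card_sum, Fintype.card_prod, Fintype.card_set, Fintype.card_fin]
  have h4 : 2 ^ (s + s) = 4 ^ s := by rw [← two_mul, pow_mul]; norm_num
  rw [h4]
  have e1 : 2 ^ s * (n - 2 * s) ≤ n * 2 ^ s := by
    rw [mul_comm]; exact Nat.mul_le_mul_right _ (Nat.sub_le _ _)
  have e2 : (n - 2 * s) * (n - 2 * s) + (s + s) ≤ n * 2 ^ s := by
    have : (n - 2 * s) * (n - 2 * s) + (s + s) ≤ n * n := by
      obtain ⟨m, rfl⟩ : ∃ m, n = m + 2 * s := ⟨n - 2 * s, by omega⟩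
      simp only [Nat.add_sub_cancel]
      nlinarith
    exact this.trans (Nat.mul_le_mul_left _ hs)
  nlinarith

end AvoidingChord

section FullTree

variable {n s : ℕ}

/-- The subtree of `T_{n,s}` formed by the whole path and the leaves in `L`. -/
def fullTree (h : 2 * s + 3 ≤ n) (L : Set (Fin s ⊕ Fin s)) : (Tns n s).Subgraph :=
  (⊤ : (Tns n s).Subgraph).induce
    (spanVerts ⟨0, by omega⟩ ⟨n - 2 * s - 1, by omega⟩ L)

lemma inl_mem_fullTree (h : 2 * s + 3 ≤ n) (L : Set (Fin s ⊕ Fin s)) (x : Fin (n - 2 * s)) :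
    .inl x ∈ (fullTree h L).verts :=
  ⟨Fin.le_def.2 (Nat.zero_le _), Fin.le_def.2 (by simp only; omega)⟩

lemma inr_mem_fullTree (h : 2 * s + 3 ≤ n) (L : Set (Fin s ⊕ Fin s)) (l : Fin s ⊕ Fin s) :
    .inr l ∈ (fullTree h L).verts ↔ l ∈ L := Iff.rfl

lemma fullTree_injective (h : 2 * s + 3 ≤ n) : Function.Injective (fullTree h) := by
  intro L L' hLL
  ext l
  rw [← inr_mem_fullTree h, hLL, inr_mem_fullTree]

lemma fullTree_mem_subtrees (h : 2 * s + 3 ≤ n) (L : Set (Fin s ⊕ Fin s)) :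
    fullTree h L ∈ subtrees (Tns n s) := by
  have hadj : ∀ a b, (fullTree h L).Adj a b ↔
      a ∈ (fullTree h L).verts ∧ b ∈ (fullTree h L).verts ∧ (Tns n s).Adj a b := fun a b => by
    simp [fullTree]
  let p : Vtx n s → Vtx n s
    | .inl x => .inl ⟨x - 1, by omega⟩
    | .inr (.inl _) => .inl ⟨0, by omega⟩
    | .inr (.inr _) => .inl ⟨n - 2 * s - 1, by omega⟩
  let ht : Vtx n s → ℕ
    | .inl x => x
    | .inr _ => n
  refine subgraph_isTree_of_parent _ (pu n s h) (inl_mem_fullTree h L _) p ht ?_ ?_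
  · rintro (x | x | x) hv hne
    · simp only [pu, ne_eq, Sum.inl.injEq, Fin.ext_iff] at hne
      simp only [hadj, p, ht, hv, inl_mem_fullTree, Tns_adj_inl_inl, true_and]
      omega
    · simp only [hadj, p, ht, hv, inl_mem_fullTree, Tns_adj_left_inl, true_and]
      omega
    · simp only [hadj, p, ht, hv, inl_mem_fullTree, Tns_adj_right_inl, true_and]
      omega
  · intro a b hab
    have hT := ((hadj a b).1 hab).2.2
    rcases a with a | a | a <;> rcases b with b | b | b <;>
      simp only [Tns_adj_inl_inl, Tns_adj_inl_left, Tns_adj_left_inl, Tns_adj_inl_right,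
        Tns_adj_right_inl, not_Tns_adj_inr_inr] at hT <;>
      simp only [p, pu, ne_eq, Sum.inl.injEq, Fin.ext_iff, reduceCtorEq, not_false_eq_true,
        true_and] <;> omega

lemma le_ncard_fullTree (h : 2 * s + 3 ≤ n) (L : Set (Fin s ⊕ Fin s)) :
    n - 2 * s ≤ (fullTree h L).verts.ncard := by
  have hsub : Set.range (Sum.inl : Fin (n - 2 * s) → Vtx n s) ⊆ (fullTree h L).verts := by
    rintro _ ⟨x, rfl⟩
    exact inl_mem_fullTree h L x
  refine le_trans ?_ (Set.ncard_le_ncard hsub)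
  rw [← Set.image_univ, Set.ncard_image_of_injective _ Sum.inl_injective, Set.ncard_univ]
  simp

end FullTree

/-- Bounds for the density of `G` from an injective family `φ` of subtrees of controlled orders that
exhausts all but at most `b` subtrees. -/
lemma den_bounds {V : Type*} [Fintype V] [Nonempty V] (G : SimpleGraph V) {ι : Type*}
    (P : Finset ι) (hP : P.Nonempty) (φ : ι → G.Subgraph) (hinj : Set.InjOn φ P)
    (hφ : ∀ p ∈ P, φ p ∈ subtrees G) (lo hi : ι → ℕ)
    (hlo : ∀ p ∈ P, lo p ≤ (φ p).verts.ncard) (hhi : ∀ p ∈ P, (φ p).verts.ncard ≤ hi p)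
    (b : ℕ) (hb : (subtrees G).ncard ≤ P.card + b) :
    ((∑ p ∈ P, lo p : ℕ) : ℝ) / (Fintype.card V * (P.card + b)) ≤ den G ∧
      den G ≤ ((∑ p ∈ P, hi p : ℕ) + Fintype.card V * b) / (Fintype.card V * P.card) := by
  classical
  set F : Finset G.Subgraph := (Set.toFinite (subtrees G)).toFinset with hF
  have hsum : ∑ᶠ H ∈ subtrees G, (H.verts.ncard : ℝ) = ∑ H ∈ F, (H.verts.ncard : ℝ) :=
    finsum_mem_eq_finite_toFinset_sum _ _
  have hcard : (subtrees G).ncard = F.card := Set.ncard_eq_toFinset_card _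
  have hsub : P.image φ ⊆ F := by
    intro H hH
    obtain ⟨p, hp, rfl⟩ := Finset.mem_image.1 hH
    simpa [hF] using hφ p hp
  have hci : (P.image φ).card = P.card := Finset.card_image_of_injOn hinj
  have hle : P.card ≤ F.card := hci ▸ Finset.card_le_card hsub
  have hcs : (F \ P.image φ).card ≤ b := by
    rw [Finset.card_sdiff_of_subset hsub, hci]; omega
  have hsplit : ∑ H ∈ F, H.verts.ncard =
      ∑ H ∈ F \ P.image φ, H.verts.ncard + ∑ p ∈ P, (φ p).verts.ncard := by
    rw [← Finset.sum_sdiff hsub, Finset.sum_image hinj]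
  have hrest : ∑ H ∈ F \ P.image φ, H.verts.ncard ≤ Fintype.card V * b := by
    refine (Finset.sum_le_card_nsmul _ _ (Fintype.card V) fun H _ => ?_).trans ?_
    · rw [← Nat.card_eq_fintype_card]; exact Set.ncard_le_card _
    · rw [smul_eq_mul, mul_comm]; exact Nat.mul_le_mul_left _ hcs
  have h1 : ∑ p ∈ P, lo p ≤ ∑ H ∈ F, H.verts.ncard :=
    (Finset.sum_le_sum hlo).trans (by omega)
  have h2 : ∑ H ∈ F, H.verts.ncard ≤ ∑ p ∈ P, hi p + Fintype.card V * b := by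
    have := Finset.sum_le_sum hhi
    omega
  have hV : (0 : ℝ) < Fintype.card V := by exact_mod_cast Fintype.card_pos
  have hP0 : (0 : ℝ) < P.card := by exact_mod_cast hP.card_pos
  have hF0 : (P.card : ℝ) ≤ F.card := by exact_mod_cast hle
  have hF1 : (F.card : ℝ) ≤ P.card + b := by rw [hcard] at hb; exact_mod_cast hb
  have hden : den G = ((∑ H ∈ F, H.verts.ncard : ℕ) : ℝ) / (Fintype.card V * F.card) := by
    rw [den, mu, numSubtrees, hsum, hcard, div_div, mul_comm (F.card : ℝ)]
    push_cast
    rfl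
  rw [hden]
  constructor
  · have : (0 : ℝ) < F.card := hP0.trans_le hF0
    gcongr
  · have h2' : ((∑ H ∈ F, H.verts.ncard : ℕ) : ℝ) ≤
        ((∑ p ∈ P, hi p : ℕ) : ℝ) + Fintype.card V * b := by exact_mod_cast h2
    gcongr

lemma card_Vtx {n s : ℕ} (h : 2 * s + 3 ≤ n) : Fintype.card (Vtx n s) = n := by
  simp only [Fintype.card_sum, Fintype.card_fin]; omega

lemma card_univ_leafSets (s : ℕ) : (Finset.univ : Finset (Set (Fin s ⊕ Fin s))).card = 4 ^ s := by
  rw [Finset.card_univ, Fintype.card_set, Fintype.card_sum, Fintype.card_fin, ← two_mul, pow_mul]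
  norm_num

lemma den_Tns_bounds {n s : ℕ} (h : 2 * s + 3 ≤ n) (hs : n ≤ 2 ^ s) :
    ((4 ^ s * (n - 2 * s) : ℕ) : ℝ) / (n * (4 ^ s + 4 * n * 2 ^ s)) ≤ den (Tns n s) ∧
      den (Tns n s) ≤ ((4 ^ s * n : ℕ) + n * (4 * n * 2 ^ s)) / (n * 4 ^ s) := by
  classical
  have : Nonempty (Vtx n s) := ⟨pu n s h⟩
  have hsub := ncard_avoiding_le h hs (Tns n s)
  have heq : {H ∈ subtrees (Tns n s) | ∀ a b, H.Adj a b → (Tns n s).Adj a b} =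
      subtrees (Tns n s) :=
    Set.sep_eq_self_iff_mem_true.2 fun H _ a b hab => hab.adj_sub
  rw [heq] at hsub
  have key := den_bounds (Tns n s) Finset.univ Finset.univ_nonempty (fullTree h)
    (fullTree_injective h).injOn (fun L _ => fullTree_mem_subtrees h L) (fun _ => n - 2 * s)
    (fun _ => n) (fun L _ => le_ncard_fullTree h L)
    (fun L _ => (Set.ncard_le_card _).trans_eq
      (Nat.card_eq_fintype_card.trans (card_Vtx h))) (4 * n * 2 ^ s) (by rwa [card_univ_leafSets])
  simp only [Finset.sum_const, card_univ_leafSets, card_Vtx h, smul_eq_mul] at key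
  simpa using key

section ArcTree

variable {n s : ℕ}

/-- The vertex set formed by the path vertices up to `i` or from `j` on and the leaves in `L`. -/
def arcVerts (i j : Fin (n - 2 * s)) (L : Set (Fin s ⊕ Fin s)) : Set (Vtx n s)
  | .inl x => x ≤ i ∨ j ≤ x
  | .inr l => l ∈ L

/-- The pair `(a, b)` consists of the `i`-th path vertex and its successor. -/
def IsGap (i : Fin (n - 2 * s)) : Vtx n s → Vtx n s → Prop
  | .inl x, .inl y => x = i ∧ (y : ℕ) = i + 1
  | _, _ => False

/-- The subtree of `G_{n,s}` through the edge `uv` formed by the path vertices up to `i` or from `j`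
on and the leaves in `L`, without the path edge from `i` to its successor. -/
def arcTree (h : 2 * s + 3 ≤ n) (i j : Fin (n - 2 * s)) (L : Set (Fin s ⊕ Fin s)) :
    (Gns n s h).Subgraph where
  verts := arcVerts i j L
  Adj a b := (Gns n s h).Adj a b ∧ a ∈ arcVerts i j L ∧ b ∈ arcVerts i j L ∧
    ¬ IsGap i a b ∧ ¬ IsGap i b a
  adj_sub hab := hab.1
  edge_vert hab := hab.2.1
  symm := ⟨fun _ _ hab => ⟨hab.1.symm, hab.2.2.1, hab.2.1, hab.2.2.2.2, hab.2.2.2.1⟩⟩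

lemma inl_mem_arcVerts (i j : Fin (n - 2 * s)) (L : Set (Fin s ⊕ Fin s)) (x : Fin (n - 2 * s)) :
    (.inl x : Vtx n s) ∈ arcVerts i j L ↔ (x : ℕ) ≤ i ∨ (j : ℕ) ≤ x := Iff.rfl

lemma inr_mem_arcVerts (i j : Fin (n - 2 * s)) (L : Set (Fin s ⊕ Fin s)) (l : Fin s ⊕ Fin s) :
    (.inr l : Vtx n s) ∈ arcVerts i j L ↔ l ∈ L := Iff.rfl

lemma arcTree_adj (h : 2 * s + 3 ≤ n) (i j : Fin (n - 2 * s)) (L : Set (Fin s ⊕ Fin s))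
    (a b : Vtx n s) : (arcTree h i j L).Adj a b ↔ (Gns n s h).Adj a b ∧ a ∈ arcVerts i j L ∧
      b ∈ arcVerts i j L ∧ ¬ IsGap i a b ∧ ¬ IsGap i b a := Iff.rfl

lemma arcTree_adj_succ (h : 2 * s + 3 ≤ n) {i j : Fin (n - 2 * s)} (hij : i < j)
    (L : Set (Fin s ⊕ Fin s)) (x y : Fin (n - 2 * s)) (hxy : (x : ℕ) + 1 = y) :
    (arcTree h i j L).Adj (.inl x) (.inl y) ↔ (x : ℕ) < i ∨ (j : ℕ) ≤ x := by
  have hij' : (i : ℕ) < j := hij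
  simp only [arcTree_adj, Gns_adj_inl_inl, inl_mem_arcVerts, IsGap, Fin.ext_iff]
  omega

lemma arcTree_injective (h : 2 * s + 3 ≤ n) {i j i' j' : Fin (n - 2 * s)}
    {L L' : Set (Fin s ⊕ Fin s)} (hij : i < j) (hij' : i' < j')
    (heq : arcTree h i j L = arcTree h i' j' L') : i = i' ∧ j = j' ∧ L = L' := by
  have key : ∀ x : ℕ, x + 1 < n - 2 * s →
      ((x < i ∨ (j : ℕ) ≤ x) ↔ (x < i' ∨ (j' : ℕ) ≤ x)) := by
    intro x hx
    rw [← arcTree_adj_succ h hij L ⟨x, by omega⟩ ⟨x + 1, hx⟩ rfl,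
      ← arcTree_adj_succ h hij' L' ⟨x, by omega⟩ ⟨x + 1, hx⟩ rfl, heq]
  have h1 : (i : ℕ) < j := hij
  have h2 : (i' : ℕ) < j' := hij'
  have k1 := key i (by omega)
  have k2 := key i' (by omega)
  have k3 := key (j - 1) (by omega)
  have k4 := key (j' - 1) (by omega)
  refine ⟨Fin.ext (by omega), Fin.ext (by omega), ?_⟩
  have hv : arcVerts i j L = arcVerts i' j' L' := congrArg SimpleGraph.Subgraph.verts heq
  ext l
  rw [← inr_mem_arcVerts i j, hv, inr_mem_arcVerts]

lemma arcTree_mem_subtrees (h : 2 * s + 3 ≤ n) {i j : Fin (n - 2 * s)} (hij : i < j)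
    (L : Set (Fin s ⊕ Fin s)) : arcTree h i j L ∈ subtrees (Gns n s h) := by
  have hij' : (i : ℕ) < j := hij
  let p : Vtx n s → Vtx n s
    | .inl x => if (x : ℕ) ≤ i then .inl ⟨x - 1, by omega⟩ else
        if hx : (x : ℕ) + 1 < n - 2 * s then .inl ⟨x + 1, hx⟩ else .inl ⟨0, by omega⟩
    | .inr (.inl _) => .inl ⟨0, by omega⟩
    | .inr (.inr _) => .inl ⟨n - 2 * s - 1, by omega⟩
  let ht : Vtx n s → ℕ
    | .inl x => if (x : ℕ) ≤ i then x else n - 2 * s - x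
    | .inr _ => n
  refine subgraph_isTree_of_parent _ (pu n s h) (.inl (Nat.zero_le _)) p ht ?_ ?_
  · rintro (x | x | x) hv hne
    · simp only [pu, ne_eq, Sum.inl.injEq, Fin.ext_iff] at hne
      change (.inl x : Vtx n s) ∈ arcVerts i j L at hv
      rw [inl_mem_arcVerts] at hv
      simp only [p, ht]
      split_ifs <;>
        simp only [arcTree_adj, Gns_adj_inl_inl, inl_mem_arcVerts, IsGap, Fin.ext_iff, true_or,
          true_and] <;>
        (try split_ifs) <;> omega
    · change (.inr (.inl x) : Vtx n s) ∈ arcVerts i j L at hv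
      simp only [p, ht, arcTree_adj, Gns_adj_left_inl, inl_mem_arcVerts, IsGap, hv, true_and,
        and_true, not_false_eq_true]
      split_ifs <;> omega
    · change (.inr (.inr x) : Vtx n s) ∈ arcVerts i j L at hv
      simp only [p, ht, arcTree_adj, Gns_adj_right_inl, inl_mem_arcVerts, IsGap, hv, true_and,
        and_true, not_false_eq_true]
      split_ifs <;> omega
  · intro a b hab
    rw [arcTree_adj] at hab
    obtain ⟨hG, ha, hb, h1, h2⟩ := hab
    rcases a with a | a | a <;> rcases b with b | b | b <;>
      simp only [Gns_adj_inl_inl, Gns_adj_inl_left, Gns_adj_left_inl, Gns_adj_inl_right,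
        Gns_adj_right_inl, not_Gns_adj_inr_inr, inl_mem_arcVerts, IsGap, Fin.ext_iff] at hG ha hb h1 h2
    · simp only [p, pu, ne_eq, Sum.inl.injEq, Fin.ext_iff]
      split_ifs <;> simp only [Sum.inl.injEq, Fin.ext_iff] <;> omega
    all_goals
      simp only [p, pu, ne_eq, Sum.inl.injEq, Fin.ext_iff, reduceCtorEq, not_false_eq_true,
        true_and]
      omega

lemma ncard_arcTree (h : 2 * s + 3 ≤ n) {i j : Fin (n - 2 * s)} (hij : i < j)
    (L : Set (Fin s ⊕ Fin s)) :
    i + 1 + (n - 2 * s - j) ≤ (arcTree h i j L).verts.ncard ∧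
      (arcTree h i j L).verts.ncard ≤ i + 1 + (n - 2 * s - j) + 2 * s := by
  classical
  have hv : (arcTree h i j L).verts =
      Sum.inl '' (↑(Finset.Iic i ∪ Finset.Ici j) : Set (Fin (n - 2 * s))) ∪ Sum.inr '' L := by
    ext (x | x)
    · simp [arcTree, inl_mem_arcVerts]
    · simp [arcTree, inr_mem_arcVerts]
  have hd : Disjoint (Finset.Iic i) (Finset.Ici j) := by
    rw [Finset.disjoint_left]
    intro x hx hx'
    exact absurd ((Finset.mem_Ici.1 hx').trans (Finset.mem_Iic.1 hx)) (not_le.2 hij)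
  have hL : L.ncard ≤ 2 * s := by
    refine (Set.ncard_le_card _).trans_eq ?_
    simp [two_mul]
  rw [hv, Set.ncard_union_eq (by
    rw [Set.disjoint_left]; rintro _ ⟨x, -, rfl⟩ ⟨y, -, h⟩; cases h),
    Set.ncard_image_of_injective _ Sum.inl_injective,
    Set.ncard_image_of_injective _ Sum.inr_injective, Set.ncard_coe_finset,
    Finset.card_union_of_disjoint hd, Fin.card_Iic, Fin.card_Ici]
  omega

/-- A subtree through `uv` misses a path edge. -/
lemma exists_not_adj_succ (h : 2 * s + 3 ≤ n) {H : (Gns n s h).Subgraph} (hH : H.coe.IsTree)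
    (huv : H.Adj (pu n s h) (pv n s h)) :
    ∃ k : ℕ, ∃ hk : k + 1 < n - 2 * s, ¬ H.Adj (.inl ⟨k, by omega⟩) (.inl ⟨k + 1, hk⟩) := by
  by_contra! hall
  have hadj : H.coe.Adj ⟨_, huv.fst_mem⟩ ⟨_, huv.snd_mem⟩ := huv
  have hbr := SimpleGraph.isAcyclic_iff_forall_adj_isBridge.1 hH.isAcyclic hadj
  rw [SimpleGraph.isBridge_iff] at hbr
  have reach : ∀ k, ∀ hk : k < n - 2 * s, ∃ hmem : .inl ⟨k, hk⟩ ∈ H.verts,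
      (H.coe.deleteEdges {s(⟨_, huv.fst_mem⟩, ⟨_, huv.snd_mem⟩)}).Reachable
        ⟨_, huv.fst_mem⟩ ⟨.inl ⟨k, hk⟩, hmem⟩ := by
    intro k
    induction k with
    | zero => exact fun hk => ⟨huv.fst_mem, SimpleGraph.Reachable.refl _⟩
    | succ k ih =>
      intro hk
      obtain ⟨hmem, hr⟩ := ih (by omega)
      refine ⟨(hall k hk).snd_mem, hr.trans (SimpleGraph.Adj.reachable ?_)⟩
      rw [SimpleGraph.deleteEdges_adj]
      refine ⟨hall k hk, ?_⟩
      simp only [Set.mem_singleton_iff, Sym2.eq_iff, Subtype.mk.injEq, pu, pv, Sum.inl.injEq,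
        Fin.ext_iff]
      omega
  exact hbr (reach (n - 2 * s - 1) (by omega)).2

/-- Every subtree of `G_{n,s}` through `uv` is an arc tree. -/
lemma exists_eq_arcTree (h : 2 * s + 3 ≤ n) {H : (Gns n s h).Subgraph} (hH : H.coe.IsTree)
    (huv : H.Adj (pu n s h) (pv n s h)) : ∃ i j L, i < j ∧ H = arcTree h i j L := by
  classical
  set E : Finset (Fin (n - 2 * s)) := Finset.univ.filter fun k =>
    ∃ hk : (k : ℕ) + 1 < n - 2 * s, ¬ H.Adj (.inl k) (.inl ⟨k + 1, hk⟩) with hE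
  have hne : E.Nonempty := by
    obtain ⟨k, hk, hk'⟩ := exists_not_adj_succ h hH huv
    exact ⟨⟨k, by omega⟩, by simpa [hE] using ⟨hk, hk'⟩⟩
  obtain ⟨i, hi, himin⟩ := Finset.exists_min_image E id hne
  obtain ⟨j, hj, hjmax⟩ := Finset.exists_max_image E id hne
  have hij : (i : ℕ) ≤ j := himin j hj
  have present : ∀ x y : Fin (n - 2 * s), (x : ℕ) + 1 = y → (x : ℕ) < i ∨ (j : ℕ) < x →
      H.Adj (.inl x) (.inl y) := by
    intro x y hxy hx
    by_contra hn
    have hxE : x ∈ E := by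
      simp only [hE, Finset.mem_filter, Finset.mem_univ, true_and]
      refine ⟨by omega, ?_⟩
      rwa [show (⟨x + 1, by omega⟩ : Fin (n - 2 * s)) = y from Fin.ext hxy]
    have h1 : (i : ℕ) ≤ x := himin x hxE
    have h2 : (x : ℕ) ≤ j := hjmax x hxE
    omega
  simp only [hE, Finset.mem_filter, Finset.mem_univ, true_and] at hi hj
  obtain ⟨hi1, hi2⟩ := hi
  obtain ⟨hj1, hj2⟩ := hj
  have missing : ∀ x y : Fin (n - 2 * s), (x : ℕ) + 1 = y → x = i ∨ x = j →
      ¬ H.Adj (.inl x) (.inl y) := by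
    rintro x y hxy (rfl | rfl)
    · rwa [show y = ⟨x + 1, hi1⟩ from Fin.ext hxy.symm]
    · rwa [show y = ⟨x + 1, hj1⟩ from Fin.ext hxy.symm]
  have hgap : ∀ x : Fin (n - 2 * s), .inl x ∈ H.verts → (x : ℕ) ≤ i ∨ (j : ℕ) + 1 ≤ x := by
    intro x hx
    by_contra! hcon
    obtain ⟨a, b, hab, ha, hb⟩ := exists_adj_cut hH.connected hx huv.fst_mem
      (Sum.inl '' {z : Fin (n - 2 * s) | (i : ℕ) < z ∧ (z : ℕ) < j + 1})
      ⟨x, ⟨hcon.1, hcon.2⟩, rfl⟩ (by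
        rintro ⟨z, ⟨hz, -⟩, hz'⟩
        rw [Sum.inl_injective hz'] at hz
        exact Nat.not_lt_zero _ hz)
    obtain ⟨a, ⟨ha1, ha2⟩, rfl⟩ := ha
    have hG := hab.adj_sub
    rcases b with b | b | b
    · simp only [Set.mem_image, Set.mem_ofPred_eq, Sum.inl.injEq, exists_eq_right] at hb
      rw [Gns_adj_inl_inl] at hG
      have hG' : (a : ℕ) + 1 = b ∨ (b : ℕ) + 1 = a := by omega
      rcases hG' with hG' | hG'
      · exact missing a b hG' (.inr (Fin.ext (by omega))) hab
      · exact missing b a hG' (.inl (Fin.ext (by omega))) hab.symm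
    · rw [Gns_adj_inl_left] at hG; omega
    · rw [Gns_adj_inl_right] at hG; omega
  have hmem : ∀ x : Fin (n - 2 * s), .inl x ∈ H.verts ↔ (x : ℕ) ≤ i ∨ (j : ℕ) + 1 ≤ x := by
    refine fun x => ⟨hgap x, ?_⟩
    rintro (hx | hx)
    · by_cases h0 : (x : ℕ) = 0
      · rw [show x = ⟨0, by omega⟩ from Fin.ext h0]
        exact huv.fst_mem
      · exact (present ⟨x - 1, by omega⟩ x (by simp only; omega)
          (.inl (by simp only; omega))).snd_mem
    · by_cases h0 : (x : ℕ) = n - 2 * s - 1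
      · rw [show x = ⟨n - 2 * s - 1, by omega⟩ from Fin.ext h0]
        exact huv.snd_mem
      · exact (present x ⟨x + 1, by omega⟩ rfl (.inr (by omega))).fst_mem
  have hleft : ∀ l, .inr (.inl l) ∈ H.verts → ∀ x : Fin (n - 2 * s), (x : ℕ) = 0 →
      H.Adj (.inr (.inl l)) (.inl x) := by
    intro l hl x hx
    obtain ⟨c, hc⟩ := exists_adj_of_ne hH.connected hl huv.fst_mem (by simp [pu])
    have hG := hc.adj_sub
    rcases c with c | c
    · rw [Gns_adj_left_inl] at hG
      rwa [show x = c from Fin.ext (by omega)]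
    · exact absurd hG (not_Gns_adj_inr_inr h _ _)
  have hright : ∀ l, .inr (.inr l) ∈ H.verts → ∀ x : Fin (n - 2 * s),
      (x : ℕ) = n - 2 * s - 1 → H.Adj (.inr (.inr l)) (.inl x) := by
    intro l hl x hx
    obtain ⟨c, hc⟩ := exists_adj_of_ne hH.connected hl huv.fst_mem (by simp [pu])
    have hG := hc.adj_sub
    rcases c with c | c
    · rw [Gns_adj_right_inl] at hG
      rwa [show x = c from Fin.ext (by omega)]
    · exact absurd hG (not_Gns_adj_inr_inr h _ _)
  have hverts : H.verts = arcVerts i ⟨j + 1, hj1⟩ {l | .inr l ∈ H.verts} := by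
    ext (x | x)
    · exact hmem x
    · rfl
  refine ⟨i, ⟨j + 1, hj1⟩, {l | .inr l ∈ H.verts}, Nat.lt_succ_of_le hij,
    SimpleGraph.Subgraph.ext (x := H) (y := arcTree h i ⟨j + 1, hj1⟩ _) hverts ?_⟩
  ext a b
  rw [arcTree_adj, ← hverts]
  constructor
  · intro hab
    refine ⟨hab.adj_sub, hab.fst_mem, hab.snd_mem, ?_, ?_⟩
    · intro hgap
      rcases a with a | a <;> rcases b with b | b <;> simp only [IsGap] at hgap
      exact missing a b (by omega) (.inl hgap.1) hab
    · intro hgap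
      rcases a with a | a <;> rcases b with b | b <;> simp only [IsGap] at hgap
      exact missing b a (by omega) (.inl hgap.1) hab.symm
  · rintro ⟨hG, ha, hb, h1, h2⟩
    rcases a with a | a | a <;> rcases b with b | b | b <;>
      simp only [Gns_adj_inl_inl, Gns_adj_inl_left, Gns_adj_left_inl, Gns_adj_inl_right,
        Gns_adj_right_inl, not_Gns_adj_inr_inr, IsGap, Fin.ext_iff] at hG h1 h2
    · rw [hmem] at ha hb
      rcases hG with hG | hG | hG | hG
      · exact present a b hG (by omega)
      · exact (present b a hG (by omega)).symm
      · have h3 : .inl a = pu n s h := congrArg Sum.inl (Fin.ext hG.1)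
        have h4 : .inl b = pv n s h := congrArg Sum.inl (Fin.ext hG.2)
        rwa [h3, h4]
      · have h3 : .inl b = pu n s h := congrArg Sum.inl (Fin.ext hG.1)
        have h4 : .inl a = pv n s h := congrArg Sum.inl (Fin.ext hG.2)
        rw [h3, h4]
        exact huv.symm
    · exact (hleft b hb a hG).symm
    · exact (hright b hb a hG).symm
    · exact hleft a ha b hG
    · exact hright a ha b hG

end ArcTree

/-- The pairs of path positions `i < j`. -/
def gapPairs (m : ℕ) : Finset (Fin m × Fin m) := Finset.univ.filter fun p => p.1 < p.2

lemma sum_gapPairs (m : ℕ) (f : ℕ → ℕ → ℝ) :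
    ∑ p ∈ gapPairs m, f p.1 p.2 = ∑ j ∈ Finset.range m, ∑ i ∈ Finset.range j, f i j := by
  rw [gapPairs, Finset.sum_filter, Fintype.sum_prod_type_right,
    ← Fin.sum_univ_eq_sum_range (fun j => ∑ i ∈ Finset.range j, f i j)]
  refine Finset.sum_congr rfl fun j _ => ?_
  simp only [Fin.lt_def]
  rw [Fin.sum_univ_eq_sum_range (fun i => if i < (j : ℕ) then f i j else 0), ← Finset.sum_filter]
  refine Finset.sum_congr ?_ fun _ _ => rfl
  ext i
  simp only [Finset.mem_filter, Finset.mem_range]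
  omega

lemma card_gapPairs (m : ℕ) : ((gapPairs m).card : ℝ) = m * (m - 1) / 2 := by
  have h := sum_gapPairs m fun _ _ => 1
  simp only [Finset.sum_const, Finset.card_range, nsmul_eq_mul, mul_one] at h
  rw [h]
  clear h
  induction m with
  | zero => simp
  | succ k ih => rw [Finset.sum_range_succ, ih]; push_cast; ring

lemma sum_gapPairs_length (m : ℕ) :
    ((∑ p ∈ gapPairs m, ((p.1 : ℕ) + 1 + (m - p.2)) : ℕ) : ℝ) = (m + 1) * m * (m - 1) / 3 := by
  have inner : ∀ (M : ℝ) (j : ℕ), ∑ i ∈ Finset.range j, ((i : ℝ) + 1 + (M - j)) =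
      j * (j + 1) / 2 + j * (M - j) := by
    intro M j
    rw [Finset.sum_add_distrib, Finset.sum_const, Finset.card_range, nsmul_eq_mul]
    congr 1
    induction j with
    | zero => simp
    | succ k ih => rw [Finset.sum_range_succ, ih]; push_cast; ring
  have outer : ∀ (M : ℝ) (m : ℕ), ∑ j ∈ Finset.range m, ((j : ℝ) * (j + 1) / 2 + j * (M - j)) =
      (m - 1) * m * (m + 1) / 6 + M * m * (m - 1) / 2 - (m - 1) * m * (2 * m - 1) / 6 := by
    intro M m
    induction m with
    | zero => simp
    | succ k ih => rw [Finset.sum_range_succ, ih]; push_cast; ring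
  have h := sum_gapPairs m fun i j => (i : ℝ) + 1 + (m - j)
  simp only [inner, outer] at h
  rw [Nat.cast_sum]
  calc _ = ∑ p ∈ gapPairs m, (((p.1 : ℕ) : ℝ) + 1 + (m - (p.2 : ℕ))) := by
        refine Finset.sum_congr rfl fun p _ => ?_
        rw [Nat.cast_add, Nat.cast_sub p.2.isLt.le]
        push_cast
        rfl
    _ = _ := by rw [h]; ring

lemma two_pow_mul_self (s : ℕ) : 2 ^ s * 2 ^ s = 4 ^ s := by
  rw [← mul_pow]; norm_num

/-- The parameters `((i, j), L)` of the arc trees. -/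
def arcParams (n s : ℕ) : Finset ((Fin (n - 2 * s) × Fin (n - 2 * s)) × Set (Fin s ⊕ Fin s)) :=
  gapPairs (n - 2 * s) ×ˢ Finset.univ

lemma mem_arcParams {n s : ℕ} (p : (Fin (n - 2 * s) × Fin (n - 2 * s)) × Set (Fin s ⊕ Fin s)) :
    p ∈ arcParams n s ↔ p.1.1 < p.1.2 := by
  simp [arcParams, gapPairs]

lemma card_arcParams (n s : ℕ) :
    (arcParams n s).card = (gapPairs (n - 2 * s)).card * 4 ^ s := by
  rw [arcParams, Finset.card_product, card_univ_leafSets]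

lemma ncard_subtrees_Gns_le {n s : ℕ} (h : 2 * s + 3 ≤ n) (hs : n ≤ 2 ^ s) :
    (subtrees (Gns n s h)).ncard ≤ (gapPairs (n - 2 * s)).card * 4 ^ s + 5 * 4 ^ s := by
  classical
  set φ : (Fin (n - 2 * s) × Fin (n - 2 * s)) × Set (Fin s ⊕ Fin s) → (Gns n s h).Subgraph :=
    fun p => arcTree h p.1.1 p.1.2 p.2
  have hsub : subtrees (Gns n s h) ⊆ φ '' (arcParams n s) ∪
      {H ∈ subtrees (Gns n s h) | ∀ a b, H.Adj a b → (Tns n s).Adj a b} := by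
    intro H hH
    by_cases huv : H.Adj (pu n s h) (pv n s h)
    · obtain ⟨i, j, L, hij, rfl⟩ := exists_eq_arcTree h hH huv
      exact .inl ⟨((i, j), L), (mem_arcParams _).2 hij, rfl⟩
    · refine .inr ⟨hH, fun a b hab => ?_⟩
      rcases (Gns_adj h a b).1 hab.adj_sub with hT | ⟨rfl, rfl⟩ | ⟨rfl, rfl⟩
      · exact hT
      · exact absurd hab huv
      · exact absurd hab.symm huv
  have h1 := Set.ncard_le_ncard hsub
  have h2 := Set.ncard_union_le (φ '' (arcParams n s))
    {H ∈ subtrees (Gns n s h) | ∀ a b, H.Adj a b → (Tns n s).Adj a b}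
  have h3 : (φ '' (arcParams n s)).ncard ≤ (gapPairs (n - 2 * s)).card * 4 ^ s := by
    rw [← card_arcParams, ← Set.ncard_coe_finset]
    exact Set.ncard_image_le
  have h5 : 4 * n * 2 ^ s ≤ 4 * 4 ^ s := by
    rw [mul_assoc, ← two_pow_mul_self]
    exact Nat.mul_le_mul_left _ (Nat.mul_le_mul_right _ hs)
  have h4 := h1.trans (h2.trans (add_le_add h3 (ncard_avoiding_le h hs (Gns n s h))))
  omega

lemma den_Gns_bounds {n s : ℕ} (h : 2 * s + 3 ≤ n) (hs : n ≤ 2 ^ s) {m : ℝ}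
    (hm : m = (n : ℝ) - 2 * s) :
    (2 / 3 * ((m + 1) / n)) / (1 + 10 / (m * (m - 1))) ≤ den (Gns n s h) ∧
      den (Gns n s h) ≤ 2 / 3 * ((m + 1) / n) + 2 * (s / n) + 10 / (m * (m - 1)) := by
  classical
  have : Nonempty (Vtx n s) := ⟨pu n s h⟩
  have hmN : ((n - 2 * s : ℕ) : ℝ) = m := by
    rw [hm, Nat.cast_sub (by omega)]; push_cast; ring
  have hm3 : 3 ≤ m := by
    rw [← hmN]; exact_mod_cast (by omega : 3 ≤ n - 2 * s)
  have hlt : ∀ p ∈ arcParams n s, p.1.1 < p.1.2 := fun p => (mem_arcParams p).1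
  have hne : (arcParams n s).Nonempty :=
    ⟨((⟨0, by omega⟩, ⟨1, by omega⟩), ∅), by simp [mem_arcParams]⟩
  have hinj : Set.InjOn (fun p : (Fin (n - 2 * s) × Fin (n - 2 * s)) × Set (Fin s ⊕ Fin s) =>
      arcTree h p.1.1 p.1.2 p.2) (arcParams n s) := by
    rintro ⟨⟨i, j⟩, L⟩ hp ⟨⟨i', j'⟩, L'⟩ hp' heq
    obtain ⟨rfl, rfl, rfl⟩ := arcTree_injective h (hlt _ hp) (hlt _ hp') heq
    rfl
  have key := den_bounds (Gns n s h) (arcParams n s) hne (fun p => arcTree h p.1.1 p.1.2 p.2) hinj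
    (fun p hp => arcTree_mem_subtrees h (hlt p hp) _)
    (fun p => p.1.1 + 1 + (n - 2 * s - p.1.2)) (fun p => p.1.1 + 1 + (n - 2 * s - p.1.2) + 2 * s)
    (fun p hp => (ncard_arcTree h (hlt p hp) _).1) (fun p hp => (ncard_arcTree h (hlt p hp) _).2)
    (5 * 4 ^ s) (by rw [card_arcParams]; exact ncard_subtrees_Gns_le h hs)
  have hsum : ((∑ p ∈ arcParams n s, ((p.1.1 : ℕ) + 1 + (n - 2 * s - p.1.2)) : ℕ) : ℝ) =
      4 ^ s * ((m + 1) * m * (m - 1) / 3) := by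
    rw [arcParams, Finset.sum_product]
    simp only [Finset.sum_const, card_univ_leafSets, smul_eq_mul]
    rw [← Finset.mul_sum, Nat.cast_mul, sum_gapPairs_length, hmN]
    push_cast
    rfl
  have hcard' : ((arcParams n s).card : ℝ) = m * (m - 1) / 2 * 4 ^ s := by
    rw [card_arcParams, Nat.cast_mul, card_gapPairs, hmN]; push_cast; rfl
  have hsum' : ((∑ p ∈ arcParams n s,
      ((p.1.1 : ℕ) + 1 + (n - 2 * s - p.1.2) + 2 * s) : ℕ) : ℝ) =
      4 ^ s * ((m + 1) * m * (m - 1) / 3) + m * (m - 1) / 2 * 4 ^ s * (2 * s) := by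
    rw [Finset.sum_add_distrib, Nat.cast_add, hsum, Finset.sum_const, smul_eq_mul, Nat.cast_mul,
      hcard']
    push_cast
    rfl
  rw [hsum, hsum', hcard', card_Vtx h] at key
  push_cast at key
  have hn : (0 : ℝ) < n := by exact_mod_cast (by omega : 0 < n)
  have h4 : (0 : ℝ) < 4 ^ s := by positivity
  have hm0 : 0 < m := by linarith
  have hm1 : 0 < m - 1 := by linarith
  refine ⟨le_trans (le_of_eq ?_) key.1, key.2.trans (le_of_eq ?_)⟩
  · field_simp
    ring
  · field_simp
    ring

lemma den_Tns_ratio_bounds {n s : ℕ} (h : 2 * s + 3 ≤ n) (hs : n ^ 2 ≤ 2 ^ s) :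
    (((n : ℝ) - 2 * s) / n) / (1 + 4 / n) ≤ den (Tns n s) ∧ den (Tns n s) ≤ 1 + 4 / n := by
  have hs' : n ≤ 2 ^ s := (Nat.le_self_pow two_ne_zero n).trans hs
  obtain ⟨h1, h2⟩ := den_Tns_bounds h hs'
  have hn : (0 : ℝ) < n := by exact_mod_cast (by omega : 0 < n)
  have hm : (0 : ℝ) ≤ (n : ℝ) - 2 * s := by
    have : (2 * s : ℝ) ≤ n := by exact_mod_cast (by omega : 2 * s ≤ n)
    linarith
  have hsR : (n : ℝ) ^ 2 ≤ 2 ^ s := by exact_mod_cast hs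
  have h2s : (0 : ℝ) < 2 ^ s := by positivity
  have h4 : (4 : ℝ) ^ s = 2 ^ s * 2 ^ s := by rw [← mul_pow]; norm_num
  have hsmall : 4 * n / (2 : ℝ) ^ s ≤ 4 / n := by
    rw [div_le_div_iff₀ h2s hn]; nlinarith
  constructor
  · refine le_trans ?_ h1
    have heq : ((4 ^ s * (n - 2 * s) : ℕ) : ℝ) / (n * (4 ^ s + 4 * n * 2 ^ s)) =
        (((n : ℝ) - 2 * s) / n) / (1 + 4 * n / 2 ^ s) := by
      rw [Nat.cast_mul, Nat.cast_sub (by omega)]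
      push_cast
      rw [h4]
      field_simp
    rw [heq]
    gcongr
  · refine h2.trans (le_trans (le_of_eq ?_) (add_le_add_right hsmall 1))
    push_cast
    rw [h4]
    field_simp

/-- If `2·s_n ≤ n - 3` for all `n ≥ k`, `s_n/n → 0`, and `2^{s_n} ≥ n²` for all
`n ≥ k`, then `Den(T_n) - Den(G_n) → 1/3`, where `T_n = T_{n,s_n}` and `G_n` is
`T_n` plus the edge `uv`. -/
theorem den_Tns_sub_den_Gns_tendsto_third (k : ℕ) (sq : ℕ → ℕ)
    (ha : ∀ n, k ≤ n → 2 * sq n + 3 ≤ n)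
    (hb : Tendsto (fun n : ℕ => (sq n : ℝ) / n) atTop (𝓝 0))
    (hc : ∀ n, k ≤ n → n ^ 2 ≤ 2 ^ sq n) :
    Tendsto (fun n : ℕ => den (Tns n (sq n)) - GnsDen n (sq n)) atTop (𝓝 (1 / 3)) := by
  have hcast : Tendsto (fun n : ℕ => (n : ℝ)) atTop atTop := tendsto_natCast_atTop_atTop
  set m : ℕ → ℝ := fun n => (n : ℝ) - 2 * sq n with hm
  have hpos : ∀ᶠ n : ℕ in atTop, (0 : ℝ) < n := hcast.eventually_gt_atTop 0
  have hratio : Tendsto (fun n => m n / n) atTop (𝓝 1) := by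
    have h1 : Tendsto (fun n : ℕ => 1 - 2 * ((sq n : ℝ) / n)) atTop (𝓝 1) := by
      simpa using (hb.const_mul 2).const_sub 1
    refine h1.congr' ?_
    filter_upwards [hpos] with n hn
    simp only [hm]
    field_simp
  have hmtop : Tendsto m atTop atTop := by
    refine (hcast.atTop_mul_pos one_pos hratio).congr' ?_
    filter_upwards [hpos] with n hn
    field_simp
  have hlead : Tendsto (fun n => 2 / 3 * ((m n + 1) / n)) atTop (𝓝 (2 / 3)) := by
    have h1 : Tendsto (fun n : ℕ => 2 / 3 * (m n / n + 1 / n)) atTop (𝓝 (2 / 3)) := by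
      simpa using (hratio.add (hcast.const_div_atTop 1)).const_mul (2 / 3)
    simpa only [add_div] using h1
  have hsmall : Tendsto (fun n => 10 / (m n * (m n - 1))) atTop (𝓝 0) :=
    (hmtop.atTop_mul_atTop₀ (tendsto_atTop_add_const_right _ (-1) hmtop)).const_div_atTop 10
  have hfour : Tendsto (fun n : ℕ => 1 + 4 / (n : ℝ)) atTop (𝓝 1) := by
    simpa using (hcast.const_div_atTop 4).const_add 1
  have hT : Tendsto (fun n : ℕ => den (Tns n (sq n))) atTop (𝓝 1) := by
    have hlow : Tendsto (fun n : ℕ => m n / n / (1 + 4 / (n : ℝ))) atTop (𝓝 1) := by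
      simpa only [div_one, Pi.div_def] using hratio.div hfour one_ne_zero
    refine tendsto_of_tendsto_of_tendsto_of_le_of_le' hlow hfour ?_ ?_
    · filter_upwards [eventually_ge_atTop k] with n hn
      exact (den_Tns_ratio_bounds (ha n hn) (hc n hn)).1
    · filter_upwards [eventually_ge_atTop k] with n hn
      exact (den_Tns_ratio_bounds (ha n hn) (hc n hn)).2
  have hG : Tendsto (fun n : ℕ => GnsDen n (sq n)) atTop (𝓝 (2 / 3)) := by
    have hlow : Tendsto (fun n => 2 / 3 * ((m n + 1) / n) / (1 + 10 / (m n * (m n - 1)))) atTop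
        (𝓝 (2 / 3)) := by
      simpa only [add_zero, div_one, Pi.div_def] using hlead.div (hsmall.const_add 1) (by norm_num)
    have hupp : Tendsto (fun n => 2 / 3 * ((m n + 1) / n) + 2 * ((sq n : ℝ) / n) +
        10 / (m n * (m n - 1))) atTop (𝓝 (2 / 3)) := by
      simpa using (hlead.add (hb.const_mul 2)).add hsmall
    have hs : ∀ n, k ≤ n → n ≤ 2 ^ sq n := fun n hn =>
      (Nat.le_self_pow two_ne_zero n).trans (hc n hn)
    refine tendsto_of_tendsto_of_tendsto_of_le_of_le' hlow hupp ?_ ?_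
    · filter_upwards [eventually_ge_atTop k] with n hn
      rw [GnsDen, dif_pos (ha n hn)]
      exact (den_Gns_bounds (ha n hn) (hs n hn) rfl).1
    · filter_upwards [eventually_ge_atTop k] with n hn
      rw [GnsDen, dif_pos (ha n hn)]
      exact (den_Gns_bounds (ha n hn) (hs n hn) rfl).2
  have hfin := hT.sub hG
  rwa [show (1 : ℝ) - 2 / 3 = 1 / 3 by norm_num] at hfin

end SubtreePaper
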